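/- Let B be a once-appearance branching program computing γ'_n whose topological order consists of consecutive triplets {x_{π(j)}, y_j, z_j} for a permutation π of [n]. If a source-to-1-sink path p in B reaches the 1-sink immediately after leaving a node in the triplet {x_i, y_j, z_j} (with i = π(j)), then p assigns the value 1 to at least two of the three variables x_i, y_j, z_j. -/

import Mathlib

/-- A deterministic branching program over `{0,1}` on `n` variables. Nodes are
numbered so that every edge goes to a strictly larger index (this fixes a
topological order and guarantees acyclicity). `Sum.inr b` denotes the `b`-sink. -/
structure BP (n : ℕ) where
  size : ℕ
  label : Fin size → Fin n
  next : Fin size → Bool → Fin size ⊕ Bool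
  source : Fin size ⊕ Bool
  wf : ∀ i b j, next i b = Sum.inl j → i < j

namespace BP

variable {n : ℕ}

/-- Fuel-based evaluation (the fuel `B.size` always suffices thanks to `wf`). -/
def evalAux (B : BP n) (x : Fin n → Bool) : ℕ → Fin B.size ⊕ Bool → Bool
  | _, Sum.inr b => b
  | 0, Sum.inl _ => false
  | k + 1, Sum.inl i => B.evalAux x k (B.next i (x (B.label i)))

/-- The Boolean value computed by the branching program on input `x`. -/
def eval (B : BP n) (x : Fin n → Bool) : Bool :=
  B.evalAux x B.size B.source

/-- `B` computes the total Boolean function `f`. -/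
def Computes (B : BP n) (f : (Fin n → Bool) → Bool) : Prop :=
  ∀ x, B.eval x = f x

/-- A once-appearance branching program: all node labels are distinct. -/
def IsOA (B : BP n) : Prop :=
  Function.Injective B.label

end BP

/-- The variable `x i` among the `3n` variables. -/
def xV (n : ℕ) (i : Fin n) : Fin (n + n + n) := Fin.castAdd n (Fin.castAdd n i)

/-- The variable `y i` among the `3n` variables. -/
def yV (n : ℕ) (i : Fin n) : Fin (n + n + n) := Fin.castAdd n (Fin.natAdd n i)

/-- The variable `z i` among the `3n` variables. -/
def zV (n : ℕ) (i : Fin n) : Fin (n + n + n) := Fin.natAdd (n + n) i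

/-- The partial function `γ'_n : {0,1}^{3n} → {0,1,*}` (`none` is `*`):
`⋁ᵢ (yᵢ ∧ zᵢ)` if `x = 0ⁿ`; `⋁ᵢ zᵢ` if `x = 1ⁿ`; `⋁ᵢ (xᵢ ∨ yᵢ)` if `z = 1ⁿ`;
`0` if `z = 0ⁿ`; `*` otherwise. -/
def gammaP (n : ℕ) (w : Fin (n + n + n) → Bool) : Option Bool :=
  if ∀ i, w (xV n i) = false then
    some (decide (∃ i : Fin n, w (yV n i) = true ∧ w (zV n i) = true))
  else if ∀ i, w (xV n i) = true then
    some (decide (∃ i : Fin n, w (zV n i) = true))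
  else if ∀ i, w (zV n i) = true then
    some (decide (∃ i : Fin n, w (xV n i) = true ∨ w (yV n i) = true))
  else if ∀ i, w (zV n i) = false then
    some false
  else none

namespace BP

variable {n : ℕ}

def ComputesPartial (B : BP n) (g : (Fin n → Bool) → Option Bool) : Prop :=
  ∀ w b, g w = some b → B.eval w = b

/-- A list of (node, chosen edge label) pairs is a chain if consecutive entries are
connected by the corresponding edges. -/
def IsChain (B : BP n) : List (Fin B.size × Bool) → Prop
  | [] => True
  | [_] => True
  | (u, b) :: (v, b') :: rest => B.next u b = Sum.inl v ∧ B.IsChain ((v, b') :: rest)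

/-- A path from the source which terminates in the `1`-sink. -/
def IsAcceptingPath (B : BP n) (p : List (Fin B.size × Bool)) : Prop :=
  B.IsChain p ∧
    (∃ u b, p.head? = some (u, b) ∧ B.source = Sum.inl u) ∧
    (∃ u b, p.getLast? = some (u, b) ∧ B.next u b = Sum.inr true)

/-- The path `p` assigns the value `α` to the variable `v`. -/
def Assigns (B : BP n) (p : List (Fin B.size × Bool)) (v : Fin n) (α : Bool) : Prop :=
  ∃ q ∈ p, B.label q.1 = v ∧ q.2 = α

end BP

/-- Read the bit `v` at the node `p`, leaving every other state unchanged. -/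
def readNode {S : Type*} [DecidableEq S] (p : S) (a : Bool → S) (v : Bool) (s : S) : S :=
  if s = p then a v else s

/-- Read three bits at the nodes `p`, `q`, `r`, in this order. -/
def readThree {S : Type*} [DecidableEq S] (p q r : S) (a b c : Bool → S) (s : S)
    (u v w : Bool) : S :=
  readNode r c w (readNode q b v (readNode p a u s))

/-- `T` processes the bits `x, y, z` of a triplet at three nodes `p`, `q`, `r`,
in this topological order, by one of the six possible orders of the bits. -/
structure IsTriplet {S : Type*} [DecidableEq S] (T : S → Bool → Bool → Bool → S)
    (p q r : S) (a b c : Bool → S) : Prop where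
  pq : p ≠ q
  pr : p ≠ r
  qr : q ≠ r
  ap : ∀ v, a v ≠ p
  bp : ∀ v, b v ≠ p
  bq : ∀ v, b v ≠ q
  cp : ∀ v, c v ≠ p
  cq : ∀ v, c v ≠ q
  cr : ∀ v, c v ≠ r
  order : (∀ s x y z, T s x y z = readThree p q r a b c s x y z) ∨
    (∀ s x y z, T s x y z = readThree p q r a b c s x z y) ∨
    (∀ s x y z, T s x y z = readThree p q r a b c s y x z) ∨
    (∀ s x y z, T s x y z = readThree p q r a b c s y z x) ∨
    (∀ s x y z, T s x y z = readThree p q r a b c s z x y) ∨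
    (∀ s x y z, T s x y z = readThree p q r a b c s z y x)

/-- Families of states reached by prefixes of a given kind. For `A`, `B`, `C` the prefix has
`x = 0` and `y ∧ z = 0`, respectively `x = 1` and `z = 0`, respectively `x = y = 0` and `z = 1`.
The families `A'`, `B'`, `C'` belong to the prefixes on which the corresponding disjunction
(`y ∧ z` for `x = 0`, `z` for `x = 1`, `x ∨ y` for `z = 1`) is already true. -/
structure Kinds (S : Type*) where
  (A A' B B' C C' : S → Prop)

/-- No state is of two contradictory kinds. -/
structure Kinds.Consistent {S : Type*} (K : Kinds S) : Prop where
  a : ∀ s, K.A s → ¬ K.A' s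
  b : ∀ s, K.B s → ¬ K.B' s
  c : ∀ s, K.C s → ¬ K.C' s

/-- How the kinds of states evolve when a triplet is processed. -/
structure Kinds.Step {S : Type*} (K L : Kinds S) (T : S → Bool → Bool → Bool → S) : Prop where
  ca : ∀ s, K.C s → K.A s
  a : ∀ s y z, K.A s → (y && z) = false → L.A (T s false y z)
  a' : ∀ s, K.A s → L.A' (T s false true true)
  a'' : ∀ s y z, K.A' s → L.A' (T s false y z)
  b : ∀ s y, K.B s → L.B (T s true y false)
  b' : ∀ s y, K.B s → L.B' (T s true y true)
  b'' : ∀ s y z, K.B' s → L.B' (T s true y z)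
  c : ∀ s, K.C s → L.C (T s false false true)
  c' : ∀ s x y, K.C s → (x || y) = true → L.C' (T s x y true)
  c'' : ∀ s x y, K.C' s → L.C' (T s x y true)

/-- The states allowed between two triplets: those reached by undecided prefixes, and those
at which the answer `1` is already forced. -/
def Kinds.IsAllowed {S : Type*} (K : Kinds S) (s : S) : Prop :=
  K.C s ∨ (K.A s ∧ K.B s) ∨ ((K.A' s ∨ K.B' s) ∧ K.C' s)

theorem IsTriplet.apply_of_ne {S : Type*} [DecidableEq S] {T : S → Bool → Bool → Bool → S}
    {p q r : S} {a b c : Bool → S} (h : IsTriplet T p q r a b c) {s : S} (hp : s ≠ p)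
    (hq : s ≠ q) (hr : s ≠ r) (x y z : Bool) : T s x y z = s := by
  rcases h.order with ho | ho | ho | ho | ho | ho <;> simp [ho, readThree, readNode, hp, hq, hr]

namespace Kinds.Step

variable {S : Type*} [DecidableEq S] {K L : Kinds S} {T : S → Bool → Bool → Bool → S}
  {p q r : S} {a b c : Bool → S}

set_option maxHeartbeats 1000000

theorem eq_first_of_C (hs : K.Step L T) (ht : IsTriplet T p q r a b c) (hL : L.Consistent)
    {s : S} (hC : K.C s) : s = p := by
  obtain ⟨h1, h2, h3, h4, h5, h6, h7, h8, h9, ho⟩ := ht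
  have hA := hs.ca s hC
  have e1 := hs.a s false true hA rfl
  have e2 := hs.a s true false hA rfl
  have e3 := hs.a s false false hA rfl
  have e4 := hs.a' s hA
  have e5 := hs.c s hC
  have e6 := hs.c' s true false hC rfl
  have e7 := hs.c' s false true hC rfl
  have := hL.a; have := hL.c
  by_contra hsp
  rcases ho with ho | ho | ho | ho | ho | ho <;> simp only [ho, readThree, readNode] at * <;> grind

theorem eq_first_or_of_A_B (hs : K.Step L T) (ht : IsTriplet T p q r a b c) (hL : L.Consistent)
    {s : S} (hA : K.A s) (hB : K.B s) :
    s = p ∨ (∃ t, L.A t ∧ L.B t) ∧ ∃ t, L.A t ∧ L.B' t := by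
  obtain ⟨h1, h2, h3, h4, h5, h6, h7, h8, h9, ho⟩ := ht
  have e1 := hs.a s false true hA rfl
  have e2 := hs.a s true false hA rfl
  have e3 := hs.a s false false hA rfl
  have e4 := hs.a' s hA
  have e5 := hs.b s false hB
  have e6 := hs.b' s false hB
  have := hL.a
  by_contra! hsp
  have i1 := fun h => hsp.2 ⟨_, e3, h⟩ _ e1
  rcases ho with ho | ho | ho | ho | ho | ho <;> simp only [ho, readThree, readNode] at * <;> grind

theorem A_B_and_A_B' (hs : K.Step L T) (ht : IsTriplet T p q r a b c) (hK : K.Consistent)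
    (hL : L.Consistent) (h : (∃ t, K.A t ∧ K.B t) ∧ ∃ t, K.A t ∧ K.B' t) :
    (∃ t, L.A t ∧ L.B t) ∧ ∃ t, L.A t ∧ L.B' t := by
  obtain ⟨⟨s, hA, hB⟩, e, hAe, hBe⟩ := h
  refine (hs.eq_first_or_of_A_B ht hL hA hB).resolve_left fun hsp => ?_
  subst hsp
  have hne : e ≠ s := fun h => hK.b s hB (h ▸ hBe)
  obtain ⟨h1, h2, h3, h4, h5, h6, h7, h8, h9, ho⟩ := ht
  have e1 := hs.a s false true hA rfl
  have e2 := hs.a s true false hA rfl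
  have e4 := hs.a' s hA
  have f1 := hs.a e false true hAe rfl
  have f2 := hs.a e true false hAe rfl
  have f4 := hs.a' e hAe
  have e5 := hs.b s false hB
  have e6 := hs.b' s false hB
  have e7 := hs.b s true hB
  have e8 := hs.b' s true hB
  have f5 := hs.b'' e false false hBe
  have f7 := hs.b'' e true false hBe
  have := hL.a; have := hL.b
  rcases ho with ho | ho | ho | ho | ho | ho <;> simp only [ho, readThree, readNode] at * <;> grind

theorem not_node_of_A'_or_B'_C' (hs : K.Step L T) (ht : IsTriplet T p q r a b c) (hK : K.Consistent)
    (hL : L.Consistent) (hB : K.B p) (hC : K.C p) {s : S} (hAB' : K.A' s ∨ K.B' s) (hC' : K.C' s) :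
    s ≠ p ∧ s ≠ q ∧ s ≠ r := by
  have hA := hs.ca p hC
  have hne : s ≠ p := fun h => hK.c s (h ▸ hC) hC'
  obtain ⟨h1, h2, h3, h4, h5, h6, h7, h8, h9, ho⟩ := ht
  refine ⟨hne, ?_⟩
  have e1 := hs.a p false true hA rfl
  have e2 := hs.a p true false hA rfl
  have e4 := hs.a' p hA
  have e5 := hs.b p false hB
  have e6 := hs.b' p false hB
  have e7 := hs.b p true hB
  have e8 := hs.b' p true hB
  have f5 := hs.b'' s false false
  have f7 := hs.b'' s true false
  have f6 := hs.a'' s false false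
  have f8 := hs.a'' s true false
  have g1 := hs.c p hC
  have g2 := hs.c' p true false hC rfl
  have g3 := hs.c' p false true hC rfl
  have g4 := hs.c'' s false false hC'
  have := hL.a; have := hL.b; have := hL.c
  rcases ho with ho | ho | ho | ho | ho | ho <;> simp only [ho, readThree, readNode] at * <;> grind

theorem exits (hs : K.Step L T) (ht : IsTriplet T p q r a b c)
    (hL : L.Consistent) (hB : K.B p) (hC : K.C p) :
    (∃ t, L.A t ∧ L.B t) ∧ ∀ x y z, L.C (T p x y z) ∨ (L.A (T p x y z) ∧ L.B (T p x y z)) ∨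
      ((L.A' (T p x y z) ∨ L.B' (T p x y z)) ∧ L.C' (T p x y z)) := by
  have hA := hs.ca p hC
  obtain ⟨h1, h2, h3, h4, h5, h6, h7, h8, h9, ho⟩ := ht
  have e0 := hs.a p false false hA rfl
  have e1 := hs.a p false true hA rfl
  have e2 := hs.a p true false hA rfl
  have e4 := hs.a' p hA
  have e5 := hs.b p false hB
  have e6 := hs.b' p false hB
  have e7 := hs.b p true hB
  have e8 := hs.b' p true hB
  have g1 := hs.c p hC
  have g2 := hs.c' p true false hC rfl
  have g3 := hs.c' p false true hC rfl
  have g4 := hs.c' p true true hC rfl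
  have := hL.a; have := hL.b; have := hL.c
  suffices (L.A (T p false true false) ∧ L.B (T p false true false)) ∧
    ∀ x y z, L.C (T p x y z) ∨ (L.A (T p x y z) ∧ L.B (T p x y z)) ∨
      ((L.A' (T p x y z) ∨ L.B' (T p x y z)) ∧ L.C' (T p x y z)) from ⟨⟨_, this.1⟩, this.2⟩
  simp only [Bool.forall_bool]
  rcases ho with ho | ho | ho | ho | ho | ho <;> simp only [ho, readThree, readNode] at * <;> grind

end Kinds.Step

section Sequential

variable {S : Type*} (T : ℕ → S → Bool → Bool → Bool → S) (s₀ : S)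

/-- The state reached after processing the first `j` triplets of `c`. -/
def stateAfter (c : ℕ → Bool × Bool × Bool) : ℕ → S
  | 0 => s₀
  | j + 1 => T j (stateAfter c j) (c j).1 (c j).2.1 (c j).2.2

/-- `s` is reached after `j` triplets all of which satisfy `P`. -/
def ReachAll (P : Bool → Bool → Bool → Bool) (j : ℕ) (s : S) : Prop :=
  ∃ c, stateAfter T s₀ c j = s ∧ ∀ k < j, P (c k).1 (c k).2.1 (c k).2.2 = true

/-- `s` is reached after `j` triplets all of which satisfy `P` and one of which satisfies `E`. -/
def ReachSome (P E : Bool → Bool → Bool → Bool) (j : ℕ) (s : S) : Prop :=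
  ∃ c, stateAfter T s₀ c j = s ∧ (∀ k < j, P (c k).1 (c k).2.1 (c k).2.2 = true) ∧
    ∃ k < j, E (c k).1 (c k).2.1 (c k).2.2 = true

variable {T s₀}

theorem stateAfter_congr {c d : ℕ → Bool × Bool × Bool} {j : ℕ} (h : ∀ k < j, c k = d k) :
    stateAfter T s₀ c j = stateAfter T s₀ d j := by
  induction j with
  | zero => rfl
  | succ j ih => simp only [stateAfter, h j (by omega), ih fun k hk => h k (by omega)]

theorem stateAfter_update (c : ℕ → Bool × Bool × Bool) (j : ℕ) (x y z : Bool) :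
    stateAfter T s₀ (Function.update c j (x, y, z)) (j + 1) = T j (stateAfter T s₀ c j) x y z := by
  have : stateAfter T s₀ (Function.update c j (x, y, z)) j = stateAfter T s₀ c j :=
    stateAfter_congr fun k hk => Function.update_of_ne (by omega) _ _
  simp [stateAfter, this]

theorem ReachAll.step {P : Bool → Bool → Bool → Bool} {j : ℕ} {s : S}
    (h : ReachAll T s₀ P j s) {x y z : Bool} (hP : P x y z = true) :
    ReachAll T s₀ P (j + 1) (T j s x y z) := by
  obtain ⟨c, rfl, hc⟩ := h
  refine ⟨Function.update c j (x, y, z), stateAfter_update .., fun k hk => ?_⟩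
  rcases eq_or_ne k j with rfl | hkj
  · simpa using hP
  · simpa [hkj] using hc k (by omega)

theorem ReachSome.step {P E : Bool → Bool → Bool → Bool} {j : ℕ} {s : S}
    (h : ReachSome T s₀ P E j s) {x y z : Bool} (hP : P x y z = true) :
    ReachSome T s₀ P E (j + 1) (T j s x y z) := by
  obtain ⟨c, rfl, hc, k₀, hk₀, hE⟩ := h
  refine ⟨Function.update c j (x, y, z), stateAfter_update .., fun k hk => ?_,
    k₀, by omega, by simpa [hk₀.ne] using hE⟩
  rcases eq_or_ne k j with rfl | hkj
  · simpa using hP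
  · simpa [hkj] using hc k (by omega)

theorem ReachAll.step_some {P Q E : Bool → Bool → Bool → Bool} {j : ℕ} {s : S}
    (h : ReachAll T s₀ P j s) (hPQ : ∀ x y z, P x y z = true → Q x y z = true)
    {x y z : Bool} (hQ : Q x y z = true) (hE : E x y z = true) :
    ReachSome T s₀ Q E (j + 1) (T j s x y z) := by
  obtain ⟨c, rfl, hc⟩ := h
  refine ⟨Function.update c j (x, y, z), stateAfter_update .., fun k hk => ?_,
    j, by omega, by simpa using hE⟩
  rcases eq_or_ne k j with rfl | hkj
  · simpa using hQ
  · simpa [hkj] using hPQ _ _ _ (hc k (by omega))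

variable (T s₀) in
/-- The kinds of the states reached after `j` triplets. -/
def kindsAfter (j : ℕ) : Kinds S where
  A := ReachAll T s₀ (fun x y z => !x && !(y && z)) j
  A' := ReachSome T s₀ (fun x _ _ => !x) (fun _ y z => y && z) j
  B := ReachAll T s₀ (fun x _ z => x && !z) j
  B' := ReachSome T s₀ (fun x _ _ => x) (fun _ _ z => z) j
  C := ReachAll T s₀ (fun x y z => !x && !y && z) j
  C' := ReachSome T s₀ (fun _ _ z => z) (fun x y _ => x || y) j

theorem kindsAfter_step (j : ℕ) :
    (kindsAfter T s₀ j).Step (kindsAfter T s₀ (j + 1)) (T j) where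
  ca := by
    rintro s ⟨c, hs, hc⟩
    refine ⟨c, hs, fun k hk => ?_⟩
    have := hc k hk
    simp only [Bool.and_eq_true, Bool.not_eq_true'] at this
    simp [this.1]
  a s y z h hyz := by
    simp only [kindsAfter] at h ⊢
    exact h.step (by simp [hyz])
  a' s h := by
    simp only [kindsAfter] at h ⊢
    exact h.step_some (by simp) rfl rfl
  a'' s y z h := by
    simp only [kindsAfter] at h ⊢
    exact h.step rfl
  b s y h := by
    simp only [kindsAfter] at h ⊢
    exact h.step rfl
  b' s y h := by
    simp only [kindsAfter] at h ⊢
    exact h.step_some (by simp) rfl rfl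
  b'' s y z h := by
    simp only [kindsAfter] at h ⊢
    exact h.step rfl
  c s h := by
    simp only [kindsAfter] at h ⊢
    exact h.step rfl
  c' s x y h hxy := by
    simp only [kindsAfter] at h ⊢
    exact h.step_some (by simp) rfl hxy
  c'' s x y h := by
    simp only [kindsAfter] at h ⊢
    exact h.step rfl

theorem kindsAfter_consistent {n : ℕ} (hn : (kindsAfter T s₀ n).Consistent) {j : ℕ}
    (hj : j ≤ n) : (kindsAfter T s₀ j).Consistent := by
  induction hj using Nat.decreasingInduction with
  | self => exact hn
  | of_succ j hj ih =>
    have hs := kindsAfter_step (T := T) (s₀ := s₀) j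
    exact ⟨fun s h h' => ih.a _ (hs.a s false false h rfl) (hs.a'' s false false h'),
      fun s h h' => ih.b _ (hs.b s false h) (hs.b'' s false false h'),
      fun s h h' => ih.c _ (hs.c s h) (hs.c'' s false false h')⟩

variable [DecidableEq S] {p q r : ℕ → S} {n : ℕ}

theorem not_A_B_and_A_B' (hT : ∀ j < n, ∃ a b c, IsTriplet (T j) (p j) (q j) (r j) a b c)
    (hn : (kindsAfter T s₀ n).Consistent)
    (hn' : ∀ s, (kindsAfter T s₀ n).A s → ¬ (kindsAfter T s₀ n).B' s) {j : ℕ} (hj : j ≤ n) :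
    ¬ ((∃ t, (kindsAfter T s₀ j).A t ∧ (kindsAfter T s₀ j).B t) ∧
      ∃ t, (kindsAfter T s₀ j).A t ∧ (kindsAfter T s₀ j).B' t) := by
  induction hj using Nat.decreasingInduction with
  | self => exact fun ⟨_, t, h, h'⟩ => hn' t h h'
  | of_succ j hj ih =>
    obtain ⟨a, b, c, ht⟩ := hT j hj
    exact fun h => ih ((kindsAfter_step j).A_B_and_A_B' ht (kindsAfter_consistent hn hj.le)
      (kindsAfter_consistent hn hj) h)

/-- Every state reached at the start of the `j`-th triplet is its first node, or none of its
nodes. -/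
theorem stateAfter_eq_first_or (hT : ∀ j < n, ∃ a b c, IsTriplet (T j) (p j) (q j) (r j) a b c)
    (hn : (kindsAfter T s₀ n).Consistent)
    (hn' : ∀ s, (kindsAfter T s₀ n).A s → ¬ (kindsAfter T s₀ n).B' s) {j : ℕ} (hj : j < n) :
    (kindsAfter T s₀ j).B (p j) ∧ (kindsAfter T s₀ j).C (p j) ∧
      ∀ c, stateAfter T s₀ c j = p j ∨
        stateAfter T s₀ c j ≠ p j ∧ stateAfter T s₀ c j ≠ q j ∧ stateAfter T s₀ c j ≠ r j := by
  have first : ∀ j < n, (∃ s, (kindsAfter T s₀ j).C s) →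
      (∃ s, (kindsAfter T s₀ j).A s ∧ (kindsAfter T s₀ j).B s) →
      (kindsAfter T s₀ j).B (p j) ∧ (kindsAfter T s₀ j).C (p j) ∧
      ∀ s, (kindsAfter T s₀ j).IsAllowed s → s = p j ∨
        (s ≠ p j ∧ s ≠ q j ∧ s ≠ r j) ∧
        ((kindsAfter T s₀ j).A' s ∨ (kindsAfter T s₀ j).B' s) ∧ (kindsAfter T s₀ j).C' s := by
    rintro j hj ⟨s, hC⟩ ⟨t, hA, hB⟩
    obtain ⟨a, b, c, ht⟩ := hT j hj
    have hs := kindsAfter_step (T := T) (s₀ := s₀) j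
    have hK := kindsAfter_consistent hn hj.le
    have hL := kindsAfter_consistent hn hj
    have hC_eq : ∀ s, (kindsAfter T s₀ j).C s → s = p j := fun s h => hs.eq_first_of_C ht hL h
    have hAB_eq : ∀ s, (kindsAfter T s₀ j).A s → (kindsAfter T s₀ j).B s → s = p j :=
      fun s h h' => (hs.eq_first_or_of_A_B ht hL h h').resolve_right
        (not_A_B_and_A_B' hT hn hn' hj)
    rw [hC_eq s hC] at hC
    rw [hAB_eq t hA hB] at hB
    refine ⟨hB, hC, ?_⟩
    rintro s (h | ⟨h, h'⟩ | ⟨h, h'⟩)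
    · exact .inl (hC_eq s h)
    · exact .inl (hAB_eq s h h')
    · exact .inr ⟨hs.not_node_of_A'_or_B'_C' ht hK hL hB hC h h', h, h'⟩
  have classify : ∀ j, j ≤ n → (∃ s, (kindsAfter T s₀ j).C s) ∧
      (∃ s, (kindsAfter T s₀ j).A s ∧ (kindsAfter T s₀ j).B s) ∧
      ∀ c, (kindsAfter T s₀ j).IsAllowed (stateAfter T s₀ c j) := by
    intro j hj
    induction j with
    | zero =>
      have h₀ : (kindsAfter T s₀ 0).A s₀ ∧ (kindsAfter T s₀ 0).B s₀ ∧ (kindsAfter T s₀ 0).C s₀ :=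
        ⟨⟨fun _ => default, rfl, by simp⟩, ⟨fun _ => default, rfl, by simp⟩,
          ⟨fun _ => default, rfl, by simp⟩⟩
      exact ⟨⟨s₀, h₀.2.2⟩, ⟨s₀, h₀.1, h₀.2.1⟩, fun c => .inl h₀.2.2⟩
    | succ j ih =>
      obtain ⟨hC, hAB, hc⟩ := ih (by omega)
      obtain ⟨hBp, hCp, hfirst⟩ := first j hj hC hAB
      obtain ⟨a, b, c, ht⟩ := hT j hj
      have hs := kindsAfter_step (T := T) (s₀ := s₀) j
      obtain ⟨hex, hall⟩ := hs.exits ht (kindsAfter_consistent hn hj) hBp hCp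
      refine ⟨⟨_, hs.c _ hCp⟩, hex, fun c => ?_⟩
      rcases hfirst _ (hc c) with h | ⟨⟨hp, hq, hr⟩, hAB', hC'⟩
      · rw [stateAfter, h]
        exact hall _ _ _
      · have hfix := ht.apply_of_ne hp hq hr
        refine .inr (.inr ⟨?_, ?_⟩)
        · rw [stateAfter, hfix]
          refine hAB'.imp (fun h => ?_) fun h => ?_
          · simpa only [hfix] using hs.a'' _ false false h
          · simpa only [hfix] using hs.b'' _ false false h
        · rw [stateAfter, hfix]
          simpa only [hfix] using hs.c'' _ false false hC'
  obtain ⟨hC, hAB, hc⟩ := classify j hj.le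
  obtain ⟨hBp, hCp, hfirst⟩ := first j hj hC hAB
  exact ⟨hBp, hCp, fun c => (hfirst _ (hc c)).imp id And.left⟩

end Sequential

theorem ReachAll.extend {S : Type*} {T : ℕ → S → Bool → Bool → Bool → S} {s₀ s : S}
    {P : Bool → Bool → Bool → Bool} {j n : ℕ} (h : ReachAll T s₀ P j s) (hjn : j ≤ n)
    (hs : ∀ k x y z, T k s x y z = s) {x y z : Bool} (hP : P x y z = true) :
    ReachAll T s₀ P n s := by
  induction n, hjn using Nat.le_induction with
  | base => exact h
  | succ n _ ih => simpa only [hs] using ih.step hP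

namespace BP

section Value

variable {m : ℕ} (B : BP m)

theorem evalAux_eq_of_fuel (w : Fin m → Bool) (k k' : ℕ) (s : Fin B.size ⊕ Bool)
    (h : ∀ i, s = Sum.inl i → B.size ≤ k + i ∧ B.size ≤ k' + i) :
    B.evalAux w k s = B.evalAux w k' s := by
  induction k generalizing k' s with
  | zero =>
    rcases s with i | b
    · have := h i rfl
      omega
    · cases k' <;> rfl
  | succ k ih =>
    rcases s with i | b
    · have := h i rfl
      obtain ⟨k', rfl⟩ : ∃ l, k' = l + 1 := ⟨k' - 1, by omega⟩
      refine ih k' _ fun j hj => ?_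
      have : (i : ℕ) < j := B.wf _ _ _ hj
      omega
    · cases k' <;> rfl

/-- The value computed on input `w` when starting at the state `s`. -/
def value (w : Fin m → Bool) (s : Fin B.size ⊕ Bool) : Bool :=
  B.evalAux w B.size s

@[simp]
theorem value_inr (w : Fin m → Bool) (b : Bool) : B.value w (Sum.inr b) = b := by
  simp [value, evalAux]

theorem value_inl (w : Fin m → Bool) (i : Fin B.size) :
    B.value w (Sum.inl i) = B.value w (B.next i (w (B.label i))) := by
  have h : B.evalAux w (B.size + 1) (Sum.inl i) = B.value w (B.next i (w (B.label i))) := rfl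
  rw [← h]
  exact B.evalAux_eq_of_fuel _ _ _ _ fun _ _ => by omega

theorem value_readNode (w : Fin m → Bool) (i : Fin B.size) (s : Fin B.size ⊕ Bool) :
    B.value w (readNode (Sum.inl i) (B.next i) (w (B.label i)) s) = B.value w s := by
  unfold readNode
  split_ifs with h
  · rw [h, value_inl]
  · rfl

/-- The state `s` is a sink, or a node of index at least `t`. -/
def AtLeast (t : ℕ) (s : Fin B.size ⊕ Bool) : Prop :=
  ∀ i, s = Sum.inl i → t ≤ i

variable {B}

theorem AtLeast.readNode {i : Fin B.size} {t : ℕ} {s : Fin B.size ⊕ Bool} (h : B.AtLeast t s)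
    (hi : (i : ℕ) = t) (v : Bool) :
    B.AtLeast (t + 1) (readNode (Sum.inl i) (B.next i) v s) := by
  intro k hk
  unfold _root_.readNode at hk
  split_ifs at hk with hs
  · have : (i : ℕ) < k := B.wf _ _ _ hk
    omega
  · have h1 := h k hk
    have h2 : (k : ℕ) ≠ i := fun h => hs (by rw [hk, Fin.ext h])
    omega

variable (B) in
/-- On input `w`, the computation from the given state ends in the node `u`, which it leaves
for the `1`-sink. -/
inductive LeadsTo (w : Fin m → Bool) (u : Fin B.size) : Fin B.size ⊕ Bool → Prop
  | last (h : B.next u (w (B.label u)) = Sum.inr true) : LeadsTo w u (Sum.inl u)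
  | step (v : Fin B.size) (h : LeadsTo w u (B.next v (w (B.label v)))) : LeadsTo w u (Sum.inl v)

theorem LeadsTo.le {w : Fin m → Bool} {u : Fin B.size} {s : Fin B.size ⊕ Bool}
    (h : B.LeadsTo w u s) : ∃ v, s = Sum.inl v ∧ v ≤ u := by
  induction h with
  | last h => exact ⟨u, rfl, le_rfl⟩
  | step v h ih =>
    obtain ⟨v', hv', hle⟩ := ih
    exact ⟨v, rfl, (B.wf _ _ _ hv').le.trans hle⟩

variable (B) in
/-- Just before time `t`, the computation either is on its way to the node `u`, or has left
this node for the `1`-sink. -/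
def EndsVia (w : Fin m → Bool) (u : Fin B.size) (t : ℕ) (s : Fin B.size ⊕ Bool) : Prop :=
  (t ≤ u → B.LeadsTo w u s) ∧ (u < t → s = Sum.inr true)

theorem EndsVia.readNode {w : Fin m → Bool} {u i : Fin B.size} {t : ℕ} {s : Fin B.size ⊕ Bool}
    (h : B.EndsVia w u t s) (hs : B.AtLeast t s) (hi : (i : ℕ) = t) :
    B.EndsVia w u (t + 1) (readNode (Sum.inl i) (B.next i) (w (B.label i)) s) := by
  unfold _root_.readNode
  refine ⟨fun htu => ?_, fun htu => ?_⟩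
  · have hl := h.1 (by omega)
    split_ifs with his
    · cases hl with
      | last h' =>
        have := Sum.inl_injective his
        subst this
        omega
      | step v h' =>
        have := Sum.inl_injective his
        subst this
        exact h'
    · exact hl
  · rcases Nat.lt_succ_iff_lt_or_eq.1 htu with hlt | heq
    · rw [h.2 hlt]
      simp
    · have hl := h.1 heq.ge
      obtain rfl : i = u := Fin.ext (by omega)
      cases hl with
      | last h' => simpa using h'
      | step v h' =>
        have h1 := hs v rfl
        obtain ⟨v', hv', hle⟩ := h'.le
        have h2 : (v : ℕ) < v' := B.wf _ _ _ hv'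
        have h3 : (v' : ℕ) ≤ i := hle
        omega

theorem IsChain.pairwise {p : List (Fin B.size × Bool)} (h : B.IsChain p) :
    p.Pairwise fun q q' => q.1 < q'.1 := by
  have : p.IsChain fun q q' => q.1 < q'.1 := by
    induction p with
    | nil => exact List.isChain_nil
    | cons q p ih =>
      cases p with
      | nil => exact List.isChain_singleton _
      | cons q' p =>
        exact List.isChain_cons_cons.2 ⟨B.wf _ _ _ h.1, ih h.2⟩
  have ht : IsTrans (Fin B.size × Bool) fun q q' => q.1 < q'.1 := ⟨fun _ _ _ => lt_trans⟩
  exact List.isChain_iff_pairwise.1 this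

theorem IsChain.leadsTo {p : List (Fin B.size × Bool)} (h : B.IsChain p) {w : Fin m → Bool}
    (hw : ∀ q ∈ p, w (B.label q.1) = q.2) {u₀ u : Fin B.size} {b₀ b : Bool}
    (hhead : p.head? = some (u₀, b₀)) (hlast : p.getLast? = some (u, b))
    (hu : B.next u b = Sum.inr true) : B.LeadsTo w u (Sum.inl u₀) := by
  induction p generalizing u₀ b₀ with
  | nil => simp at hhead
  | cons q p ih =>
    obtain rfl : q = (u₀, b₀) := by simpa using hhead
    have hq : w (B.label u₀) = b₀ := hw _ List.mem_cons_self
    cases p with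
    | nil =>
      obtain ⟨rfl, rfl⟩ : u₀ = u ∧ b₀ = b := by simpa using hlast
      exact .last (hq ▸ hu)
    | cons q' p =>
      refine .step _ ?_
      rw [hq, h.1]
      exact ih h.2 (fun q hq => hw q (List.mem_cons_of_mem _ hq)) rfl
        (by simpa [List.getLast?_cons_cons] using hlast)

open Classical in
variable (B) in
/-- The input which is `1` exactly at the variables to which `p` assigns `1`. -/
noncomputable def pathInput (p : List (Fin B.size × Bool)) (v : Fin m) : Bool :=
  decide (B.Assigns p v true)

theorem pathInput_eq_true {p : List (Fin B.size × Bool)} {v : Fin m} :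
    B.pathInput p v = true ↔ B.Assigns p v true := by
  simp [pathInput]

theorem IsChain.pathInput_label {p : List (Fin B.size × Bool)} (h : B.IsChain p) (hoa : B.IsOA)
    {q : Fin B.size × Bool} (hq : q ∈ p) : B.pathInput p (B.label q.1) = q.2 := by
  obtain ⟨v, b⟩ := q
  cases b with
  | true => exact pathInput_eq_true.2 ⟨_, hq, rfl, rfl⟩
  | false =>
    rw [Bool.eq_false_iff, Ne, pathInput_eq_true]
    rintro ⟨⟨v', b'⟩, hq', hlabel, rfl⟩
    obtain rfl : v' = v := hoa hlabel
    have hne : ((v', true) : Fin B.size × Bool) ≠ (v', false) := by simp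
    have : p.Pairwise fun q q' => q.1 ≠ q'.1 := h.pairwise.imp fun h => h.ne
    have hsymm : Std.Symm fun q q' : Fin B.size × Bool => q.1 ≠ q'.1 := ⟨fun _ _ h => h.symm⟩
    exact this.forall hq' hq hne rfl

end Value

section Triplets

variable {n : ℕ} (B : BP (n + n + n)) (π : Equiv.Perm (Fin n))

/-- The node with index `t`, or a sink if there is none. -/
def node (t : ℕ) : Fin B.size ⊕ Bool :=
  if ht : t < B.size then Sum.inl ⟨t, ht⟩ else Sum.inr false

/-- The bit of the triplet `(x, y, z)` which is queried under the label `v`. -/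
def tripletBit (j : Fin n) (x y z : Bool) (v : Fin (n + n + n)) : Bool :=
  if v = xV n (π j) then x else if v = yV n j then y else z

/-- The position of the `i`-th node of the `j`-th triplet. -/
def tripletPos (h : B.size = n + n + n) (j : Fin n) (i : Fin 3) : Fin B.size :=
  Fin.cast h.symm ⟨3 * j + i, by omega⟩

/-- Processing the `j`-th triplet of variables. -/
def tripletStep (h : B.size = n + n + n) (j : ℕ) (s : Fin B.size ⊕ Bool) (x y z : Bool) :
    Fin B.size ⊕ Bool :=
  if hj : j < n then
    let i := B.tripletPos h ⟨j, hj⟩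
    let v := fun k => tripletBit π ⟨j, hj⟩ x y z (B.label (i k))
    readThree (Sum.inl (i 0)) (Sum.inl (i 1)) (Sum.inl (i 2))
      (B.next (i 0)) (B.next (i 1)) (B.next (i 2)) s (v 0) (v 1) (v 2)
  else s

/-- The labels of the nodes are grouped into the consecutive triplets
`{x_{π j}, y_j, z_j}`. -/
def HasTriplets (h : B.size = n + n + n) : Prop :=
  ∀ j : Fin n, ({B.label (B.tripletPos h j 0), B.label (B.tripletPos h j 1),
    B.label (B.tripletPos h j 2)} : Set (Fin (n + n + n))) = {xV n (π j), yV n j, zV n j}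

theorem xV_ne_yV (i j : Fin n) : xV n i ≠ yV n j := by
  simp only [xV, yV, Ne, Fin.ext_iff, Fin.val_castAdd, Fin.val_natAdd]
  omega

theorem xV_ne_zV (i j : Fin n) : xV n i ≠ zV n j := by
  simp only [xV, zV, Ne, Fin.ext_iff, Fin.val_castAdd, Fin.val_natAdd]
  omega

theorem yV_ne_zV (i j : Fin n) : yV n i ≠ zV n j := by
  simp only [yV, zV, Ne, Fin.ext_iff, Fin.val_castAdd, Fin.val_natAdd]
  omega

variable {B π} {h : B.size = n + n + n}

theorem val_tripletPos (j : Fin n) (i : Fin 3) : (B.tripletPos h j i : ℕ) = 3 * j + i := rfl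

theorem tripletPos_eq_node (j : Fin n) (i : Fin 3) :
    Sum.inl (B.tripletPos h j i) = B.node (3 * j + i) := by
  have : 3 * (j : ℕ) + i < B.size := (B.tripletPos h j i).isLt
  simp only [node, this, dite_true]
  rfl

theorem label_tripletPos_mem (ht : B.HasTriplets π h) (j : Fin n) (i : Fin 3) :
    B.label (B.tripletPos h j i) = xV n (π j) ∨ B.label (B.tripletPos h j i) = yV n j ∨
      B.label (B.tripletPos h j i) = zV n j := by
  have : B.label (B.tripletPos h j i) ∈ ({xV n (π j), yV n j, zV n j} : Set _) := by
    rw [← ht j]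
    fin_cases i <;> simp
  simpa using this

theorem exists_tripletPos (hoa : B.IsOA) (ht : B.HasTriplets π h) {j : Fin n} {u : Fin B.size}
    (hu : B.label u ∈ ({xV n (π j), yV n j, zV n j} : Set _)) : ∃ i, u = B.tripletPos h j i := by
  rw [← ht j] at hu
  rcases hu with hu | hu | hu
  · exact ⟨0, hoa hu⟩
  · exact ⟨1, hoa hu⟩
  · exact ⟨2, hoa hu⟩

theorem next_ne_of_le {i k : Fin B.size} (hki : k ≤ i) (v : Bool) : B.next i v ≠ Sum.inl k :=
  fun hv => absurd (B.wf _ _ _ hv) hki.not_gt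

theorem isTriplet_tripletStep (hoa : B.IsOA) (ht : B.HasTriplets π h) {j : ℕ} (hj : j < n) :
    ∃ a b c, IsTriplet (B.tripletStep π h j) (B.node (3 * j)) (B.node (3 * j + 1))
      (B.node (3 * j + 2)) a b c := by
  lift j to Fin n using hj
  have e := tripletPos_eq_node (h := h) j
  have h01 : B.tripletPos h j 0 < B.tripletPos h j 1 := Nat.lt_succ_self (3 * (j : ℕ))
  have h12 : B.tripletPos h j 1 < B.tripletPos h j 2 := Nat.lt_succ_self (3 * (j : ℕ) + 1)
  have e0 : _ = B.node (3 * j) := e 0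
  have e1 : _ = B.node (3 * j + 1) := e 1
  have e2 : _ = B.node (3 * j + 2) := e 2
  have n01 := hoa.ne h01.ne
  have n12 := hoa.ne h12.ne
  have n02 := hoa.ne (h01.trans h12).ne
  refine ⟨B.next (B.tripletPos h j 0), B.next (B.tripletPos h j 1), B.next (B.tripletPos h j 2),
    ?_⟩
  rw [← e0, ← e1, ← e2]
  refine ⟨Sum.inl_injective.ne h01.ne, Sum.inl_injective.ne (h01.trans h12).ne,
    Sum.inl_injective.ne h12.ne, next_ne_of_le le_rfl, next_ne_of_le h01.le,
    next_ne_of_le le_rfl, next_ne_of_le (h01.trans h12).le, next_ne_of_le h12.le,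
    next_ne_of_le le_rfl, ?_⟩
  have hxy := xV_ne_yV (π j) j
  have hxz := xV_ne_zV (π j) j
  have hyz := yV_ne_zV j j
  simp only [tripletStep, j.isLt, dite_true, Fin.eta]
  rcases label_tripletPos_mem ht j 0 with l0 | l0 | l0 <;>
  rcases label_tripletPos_mem ht j 1 with l1 | l1 | l1 <;>
  rcases label_tripletPos_mem ht j 2 with l2 | l2 | l2 <;>
  rw [l0, l1] at n01 <;> rw [l1, l2] at n12 <;> rw [l0, l2] at n02 <;>
  first
  | exact absurd rfl n01
  | exact absurd rfl n12
  | exact absurd rfl n02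
  | simp [l0, l1, l2, tripletBit, hxy.symm, hxz.symm, hyz.symm]

/-- Processing a triplet amounts to reading the bits of `w` at its three nodes. -/
theorem tripletStep_eq (ht : B.HasTriplets π h) (j : Fin n) (w : Fin (n + n + n) → Bool)
    (s : Fin B.size ⊕ Bool) :
    B.tripletStep π h j s (w (xV n (π j))) (w (yV n j)) (w (zV n j)) =
      readThree (Sum.inl (B.tripletPos h j 0)) (Sum.inl (B.tripletPos h j 1))
        (Sum.inl (B.tripletPos h j 2)) (B.next (B.tripletPos h j 0))
        (B.next (B.tripletPos h j 1)) (B.next (B.tripletPos h j 2)) s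
        (w (B.label (B.tripletPos h j 0))) (w (B.label (B.tripletPos h j 1)))
        (w (B.label (B.tripletPos h j 2))) := by
  have hbit : ∀ i, tripletBit π j (w (xV n (π j))) (w (yV n j)) (w (zV n j))
      (B.label (B.tripletPos h j i)) = w (B.label (B.tripletPos h j i)) := by
    intro i
    have hxy := xV_ne_yV (π j) j
    have hxz := xV_ne_zV (π j) j
    have hyz := yV_ne_zV j j
    rcases label_tripletPos_mem ht j i with l | l | l <;>
      simp [l, tripletBit, hxy.symm, hxz.symm, hyz.symm]
  simp only [tripletStep, j.isLt, dite_true, Fin.eta, hbit]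

theorem tripletStep_inr (j : ℕ) (b x y z : Bool) :
    B.tripletStep π h j (Sum.inr b) x y z = Sum.inr b := by
  unfold tripletStep
  split_ifs <;> simp [readThree, readNode]

/-- The triplets of bits of an input. -/
def triplets (π : Equiv.Perm (Fin n)) (w : Fin (n + n + n) → Bool) (j : ℕ) : Bool × Bool × Bool :=
  if hj : j < n then (w (xV n (π ⟨j, hj⟩)), w (yV n ⟨j, hj⟩), w (zV n ⟨j, hj⟩)) else default

/-- The input with the given triplets of bits. -/
def ofTriplets (π : Equiv.Perm (Fin n)) (c : ℕ → Bool × Bool × Bool) : Fin (n + n + n) → Bool :=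
  Fin.addCases (Fin.addCases (fun i => (c (π.symm i)).1) fun j => (c j).2.1) fun j => (c j).2.2

@[simp]
theorem ofTriplets_xV (c : ℕ → Bool × Bool × Bool) (i : Fin n) :
    ofTriplets π c (xV n i) = (c (π.symm i)).1 := by
  simp [ofTriplets, xV]

@[simp]
theorem ofTriplets_yV (c : ℕ → Bool × Bool × Bool) (j : Fin n) :
    ofTriplets π c (yV n j) = (c j).2.1 := by
  unfold ofTriplets yV
  rw [Fin.addCases_left, Fin.addCases_right]

@[simp]
theorem ofTriplets_zV (c : ℕ → Bool × Bool × Bool) (j : Fin n) :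
    ofTriplets π c (zV n j) = (c j).2.2 := by
  simp [ofTriplets, zV]

theorem triplets_ofTriplets (c : ℕ → Bool × Bool × Bool) {j : ℕ} (hj : j < n) :
    triplets π (ofTriplets π c) j = c j := by
  simp [triplets, hj]

/-- A property of computations preserved at every node holds between the triplets. -/
theorem stateAfter_induction (ht : B.HasTriplets π h) (w : Fin (n + n + n) → Bool)
    (Q : ℕ → Fin B.size ⊕ Bool → Prop) (h₀ : Q 0 B.source)
    (hQ : ∀ (i : Fin B.size) s, Q i s →
      Q (i + 1) (readNode (Sum.inl i) (B.next i) (w (B.label i)) s)) {j : ℕ} (hj : j ≤ n) :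
    Q (3 * j) (stateAfter (B.tripletStep π h) B.source (triplets π w) j) := by
  induction j with
  | zero => exact h₀
  | succ j ih =>
    have hjn : j < n := hj
    have := tripletStep_eq ht ⟨j, hjn⟩ w (stateAfter (B.tripletStep π h) B.source (triplets π w) j)
    simp only [stateAfter, triplets, hjn, dite_true] at this ⊢
    rw [this]
    exact hQ (B.tripletPos h ⟨j, hjn⟩ 2) _ (hQ (B.tripletPos h ⟨j, hjn⟩ 1) _
      (hQ (B.tripletPos h ⟨j, hjn⟩ 0) _ (ih hjn.le)))

theorem stateAfter_eq_sink (ht : B.HasTriplets π h) (c : ℕ → Bool × Bool × Bool) :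
    stateAfter (B.tripletStep π h) B.source c n = Sum.inr (B.eval (ofTriplets π c)) := by
  rw [stateAfter_congr fun k hk => (triplets_ofTriplets (π := π) c hk).symm]
  obtain ⟨hv, hl⟩ := stateAfter_induction ht (ofTriplets π c)
    (fun t s => B.value (ofTriplets π c) s = B.eval (ofTriplets π c) ∧ B.AtLeast t s)
    ⟨rfl, fun _ _ => Nat.zero_le _⟩
    (fun i s hs => ⟨(B.value_readNode _ i s).trans hs.1, hs.2.readNode rfl _⟩) le_rfl
  rcases hs : stateAfter (B.tripletStep π h) B.source (triplets π (ofTriplets π c)) n with i | b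
  · have := hl i hs
    omega
  · rw [hs, value_inr] at hv
    rw [hv]

theorem stateAfter_eq_of_gammaP (ht : B.HasTriplets π h) (hcomp : B.ComputesPartial (gammaP n))
    {c : ℕ → Bool × Bool × Bool} {b : Bool} (hc : gammaP n (ofTriplets π c) = some b) :
    stateAfter (B.tripletStep π h) B.source c n = Sum.inr b := by
  rw [stateAfter_eq_sink ht, hcomp _ _ hc]

theorem eq_inr_of_A (ht : B.HasTriplets π h) (hcomp : B.ComputesPartial (gammaP n))
    {s : Fin B.size ⊕ Bool} (hs : (kindsAfter (B.tripletStep π h) B.source n).A s) :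
    s = Sum.inr false := by
  obtain ⟨c, rfl, hc⟩ := hs
  refine stateAfter_eq_of_gammaP ht hcomp ?_
  simp only [Bool.and_eq_true, Bool.not_eq_true', Bool.and_eq_false_iff] at hc
  have hx : ∀ i : Fin n, (c (π.symm i)).1 = false := fun i => (hc _ (π.symm i).isLt).1
  have hyz := fun i : Fin n => (hc i i.isLt).2
  simp only [gammaP, ofTriplets_xV, ofTriplets_yV, ofTriplets_zV, hx]
  simpa [← Bool.not_eq_true, ← not_and_or] using hyz

theorem eq_inr_of_A' (ht : B.HasTriplets π h) (hcomp : B.ComputesPartial (gammaP n))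
    {s : Fin B.size ⊕ Bool} (hs : (kindsAfter (B.tripletStep π h) B.source n).A' s) :
    s = Sum.inr true := by
  obtain ⟨c, rfl, hc, k, hk, hyz⟩ := hs
  refine stateAfter_eq_of_gammaP ht hcomp ?_
  simp only [Bool.not_eq_true', Bool.and_eq_true] at hc hyz
  have hx : ∀ i : Fin n, (c (π.symm i)).1 = false := fun i => hc _ (π.symm i).isLt
  simp only [gammaP, ofTriplets_xV, ofTriplets_yV, ofTriplets_zV, hx]
  simpa using ⟨⟨k, hk⟩, hyz⟩

theorem eq_inr_of_B (ht : B.HasTriplets π h) (hcomp : B.ComputesPartial (gammaP n))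
    {s : Fin B.size ⊕ Bool} (hs : (kindsAfter (B.tripletStep π h) B.source n).B s) :
    s = Sum.inr false := by
  obtain ⟨c, rfl, hc⟩ := hs
  refine stateAfter_eq_of_gammaP ht hcomp ?_
  simp only [Bool.and_eq_true, Bool.not_eq_true'] at hc
  have hx : ∀ i : Fin n, (c (π.symm i)).1 = true := fun i => (hc _ (π.symm i).isLt).1
  have hz := fun i : Fin n => (hc i i.isLt).2
  simp [gammaP, hx, hz]

theorem eq_inr_of_B' (ht : B.HasTriplets π h) (hcomp : B.ComputesPartial (gammaP n))
    {s : Fin B.size ⊕ Bool} (hs : (kindsAfter (B.tripletStep π h) B.source n).B' s) :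
    s = Sum.inr true := by
  obtain ⟨c, rfl, hc, k, hk, hz⟩ := hs
  refine stateAfter_eq_of_gammaP ht hcomp ?_
  have hx : ∀ i : Fin n, (c (π.symm i)).1 = true := fun i => hc _ (π.symm i).isLt
  have hn : Nonempty (Fin n) := ⟨⟨k, hk⟩⟩
  simp only [gammaP, ofTriplets_xV, ofTriplets_yV, ofTriplets_zV, hx]
  simpa using ⟨⟨k, hk⟩, hz⟩

theorem eq_inr_of_C (ht : B.HasTriplets π h) (hcomp : B.ComputesPartial (gammaP n))
    {s : Fin B.size ⊕ Bool} (hs : (kindsAfter (B.tripletStep π h) B.source n).C s) :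
    s = Sum.inr false :=
  eq_inr_of_A ht hcomp (by
    obtain ⟨c, rfl, hc⟩ := hs
    refine ⟨c, rfl, fun k hk => ?_⟩
    have := hc k hk
    simp only [Bool.and_eq_true, Bool.not_eq_true'] at this
    simp [this.1])

theorem eq_inr_of_C' (ht : B.HasTriplets π h) (hcomp : B.ComputesPartial (gammaP n))
    {s : Fin B.size ⊕ Bool} (hs : (kindsAfter (B.tripletStep π h) B.source n).C' s) :
    s = Sum.inr true := by
  obtain ⟨c, rfl, hc, k, hk, hxy⟩ := hs
  refine stateAfter_eq_of_gammaP ht hcomp ?_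
  have hz : ∀ i : Fin n, (c i).2.2 = true := fun i => hc _ i.isLt
  have hn : Nonempty (Fin n) := ⟨⟨k, hk⟩⟩
  simp only [Bool.or_eq_true] at hxy
  simp only [gammaP, ofTriplets_xV, ofTriplets_yV, ofTriplets_zV, hz]
  split_ifs with h1 h2
  · have hx := h1 (π ⟨k, hk⟩)
    simp only [Equiv.symm_apply_apply] at hx
    simpa using ⟨⟨k, hk⟩, hxy.resolve_left (by simp [hx])⟩
  · simp
  · simp only [Option.some.injEq, decide_eq_true_eq]
    rcases hxy with hx | hy
    · exact ⟨π ⟨k, hk⟩, .inl (by simpa using hx)⟩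
    · exact ⟨⟨k, hk⟩, .inr hy⟩
  all_goals simp_all

theorem kindsAfter_tripletStep_consistent (ht : B.HasTriplets π h)
    (hcomp : B.ComputesPartial (gammaP n)) :
    (kindsAfter (B.tripletStep π h) B.source n).Consistent where
  a s hs hs' := by simpa using (eq_inr_of_A ht hcomp hs).symm.trans (eq_inr_of_A' ht hcomp hs')
  b s hs hs' := by simpa using (eq_inr_of_B ht hcomp hs).symm.trans (eq_inr_of_B' ht hcomp hs')
  c s hs hs' := by simpa using (eq_inr_of_C ht hcomp hs).symm.trans (eq_inr_of_C' ht hcomp hs')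

/-- If, after leaving the first node of a triplet, the `1`-sink is reached within the triplet,
then at least two of its three bits are `1`. -/
theorem two_ones_of_tripletStep_eq (ht : B.HasTriplets π h)
    (hcomp : B.ComputesPartial (gammaP n)) {j : ℕ} (hj : j < n) {s : Fin B.size ⊕ Bool}
    (hB : (kindsAfter (B.tripletStep π h) B.source j).B s)
    (hC : (kindsAfter (B.tripletStep π h) B.source j).C s) {x y z : Bool}
    (hxyz : B.tripletStep π h j s x y z = Sum.inr true) :
    x = true ∧ y = true ∨ x = true ∧ z = true ∨ y = true ∧ z = true := by
  have hs := kindsAfter_step (T := B.tripletStep π h) (s₀ := B.source) j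
  have hA := hs.ca s hC
  have hAn : ¬ (kindsAfter (B.tripletStep π h) B.source (j + 1)).A (Sum.inr true) := by
    simp only [kindsAfter]
    intro hL
    have := hL.extend (x := false) (y := false) (z := false) hj
      (fun k x y z => tripletStep_inr k true x y z) rfl
    simpa using eq_inr_of_A ht hcomp this
  have hBn : ¬ (kindsAfter (B.tripletStep π h) B.source (j + 1)).B (Sum.inr true) := by
    simp only [kindsAfter]
    intro hL
    have := hL.extend (x := true) (y := false) (z := false) hj
      (fun k x y z => tripletStep_inr k true x y z) rfl
    simpa using eq_inr_of_B ht hcomp this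
  cases x with
  | false =>
    have := mt (hs.a s y z hA) (hxyz ▸ hAn)
    simp_all
  | true =>
    cases z with
    | false => exact absurd (hs.b s y hB) (hxyz ▸ hBn)
    | true => simp

end Triplets

end BP

/-- let `B` be an oaBP computing `γ'_n` whose topological order consists of
consecutive triplets `{x_{π j}, y_j, z_j}`. If a source-to-`1`-sink path reaches the
`1`-sink immediately after leaving a node of the triplet `{x_{π j}, y_j, z_j}`, then it
assigns the value `1` to at least two of the three variables `x_{π j}, y_j, z_j`. -/
theorem accepting_path_needs_two_ones (n : ℕ) (B : BP (n + n + n)) (hoa : B.IsOA)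
    (hcomp : B.ComputesPartial (gammaP n)) (h : B.size = n + n + n)
    (π : Equiv.Perm (Fin n))
    (htrip : ∀ j : Fin n,
      ({B.label (Fin.cast h.symm ⟨3 * j.val, by have := j.isLt; omega⟩),
          B.label (Fin.cast h.symm ⟨3 * j.val + 1, by have := j.isLt; omega⟩),
          B.label (Fin.cast h.symm ⟨3 * j.val + 2, by have := j.isLt; omega⟩)} :
        Set (Fin (n + n + n))) = {xV n (π j), yV n j, zV n j}) :
    ∀ p, B.IsAcceptingPath p → ∀ u b, p.getLast? = some (u, b) → ∀ j : Fin n,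
      B.label u ∈ ({xV n (π j), yV n j, zV n j} : Set (Fin (n + n + n))) →
      (B.Assigns p (xV n (π j)) true ∧ B.Assigns p (yV n j) true) ∨
        (B.Assigns p (xV n (π j)) true ∧ B.Assigns p (zV n j) true) ∨
        (B.Assigns p (yV n j) true ∧ B.Assigns p (zV n j) true) := by
  rintro p ⟨hchain, ⟨u₀, b₀, hhead, hsource⟩, ⟨u', b', hlast', hu⟩⟩ u b hlast j hju
  obtain ⟨rfl, rfl⟩ : u = u' ∧ b = b' := by simpa [hlast] using hlast'
  have ht : B.HasTriplets π h := htrip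
  simp only [← BP.pathInput_eq_true]
  have hleads : B.LeadsTo (B.pathInput p) u B.source := hsource ▸
    hchain.leadsTo (fun q hq => hchain.pathInput_label hoa hq) hhead hlast hu
  have hvia : ∀ k ≤ n, _ := fun k hk => BP.stateAfter_induction ht (B.pathInput p)
    (fun t s => B.EndsVia (B.pathInput p) u t s ∧ B.AtLeast t s)
    ⟨⟨fun _ => hleads, fun hu => absurd hu (Nat.not_lt_zero _)⟩, fun _ _ => Nat.zero_le _⟩
    (fun i s hs => ⟨hs.1.readNode hs.2 rfl, hs.2.readNode rfl _⟩) hk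
  obtain ⟨i, rfl⟩ := BP.exists_tripletPos hoa ht hju
  have hi := BP.val_tripletPos (h := h) j i
  obtain ⟨hB, hC, hfirst⟩ := stateAfter_eq_first_or
    (fun k hk => BP.isTriplet_tripletStep hoa ht hk)
    (BP.kindsAfter_tripletStep_consistent ht hcomp)
    (fun s hs hs' => by
      simpa using (BP.eq_inr_of_A ht hcomp hs).symm.trans (BP.eq_inr_of_B' ht hcomp hs')) j.isLt
  have hnode : stateAfter (B.tripletStep π h) B.source (BP.triplets π (B.pathInput p)) j =
      B.node (3 * j) := by
    refine (hfirst _).resolve_right ?_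
    rintro ⟨hp, hq, hr⟩
    obtain ⟨hends, hge⟩ := hvia j j.isLt.le
    obtain ⟨v, hv, hvu⟩ := (hends.1 (by omega)).le
    have hv' : 3 * (j : ℕ) ≤ v := hge v hv
    have hvu : (v : ℕ) ≤ B.tripletPos h j i := hvu
    obtain ⟨k, rfl⟩ : ∃ k, v = B.tripletPos h j k :=
      ⟨⟨v - 3 * j, by omega⟩, Fin.ext (by simp only [BP.val_tripletPos]; omega)⟩
    rw [BP.tripletPos_eq_node] at hv
    fin_cases k
    exacts [hp hv, hq hv, hr hv]
  have hsink := (hvia (j + 1) j.isLt).1.2 (by omega)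
  simp only [stateAfter, hnode, BP.triplets, j.isLt, dite_true, Fin.eta] at hsink
  exact BP.two_ones_of_tripletStep_eq ht hcomp j.isLt hB hC hsink
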